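/- For any biconed graph G^{A,B}, the multicomplex of 2-edge-rooted forests of G^{A,B}_red is pure: all of its inclusion-maximal elements have the same degree. -/

import Mathlib

/-!
Formalization scaffold for "h-vectors of graphic matroids of biconed graphs".

A graph `G` (loops and parallel edges allowed) with vertex set `A ∪ B` is
modelled by an abstract finite edge type `E` with an endpoint map
`ends : E → Sym2 (Fin m ⊕ₗ Fin n)`, where `A = Fin m = {1,…,m}`,
`Ā = B \ A = Fin n = {1̄,…,n̄}` and the finset `S ⊆ Fin m` records `A ∩ B`
(so `B = S ∪ Ā`).  The biconing `G^{A,B}` adds the two vertices `0` and `0̄`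
and the edges `00̄`, `0a (a ∈ A)` and `0̄b (b ∈ B)`.
-/

namespace BiconedPaper

noncomputable section
open scoped Classical

/-! ### Walks in multigraphs presented by an endpoint map -/

/-- A walk in the multigraph with edge set `ε` and endpoint map `ends`. -/
inductive MWalk {ε ν : Type} (ends : ε → Sym2 ν) : ν → ν → Type
  | nil (u : ν) : MWalk ends u u
  | cons {u w : ν} (e : ε) (v : ν) (h : ends e = s(u, v)) (p : MWalk ends v w) :
      MWalk ends u w

namespace MWalk

variable {ε ν : Type} {ends : ε → Sym2 ν}

/-- The list of edges traversed by a walk. -/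
def edges : ∀ {u v : ν}, MWalk ends u v → List ε
  | _, _, nil _ => []
  | _, _, cons e _ _ p => e :: p.edges

/-- The list of vertices visited by a walk. -/
def support : ∀ {u v : ν}, MWalk ends u v → List ν
  | u, _, nil _ => [u]
  | u, _, cons _ _ _ p => u :: p.support

/-- A walk is a path if it visits no vertex twice. -/
def IsPath {u v : ν} (p : MWalk ends u v) : Prop := p.support.Nodup

/-- All edges of the walk belong to the edge set `F`. -/
def edgesIn {u v : ν} (p : MWalk ends u v) (F : Finset ε) : Prop :=
  ∀ e ∈ p.edges, e ∈ F

/-- The number of "bridging" edges traversed by a walk, i.e. steps whose two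
endpoints lie on different sides according to `sideF`. -/
def bridgeCount (sideF : ν → Bool) : ∀ {u v : ν}, MWalk ends u v → ℕ
  | _, _, nil _ => 0
  | u, _, cons _ v' _ p => (if sideF u = sideF v' then 0 else 1) + p.bridgeCount sideF

end MWalk

/-- `u` and `v` are joined by a walk all of whose edges lie in `F`. -/
def Reachable {ε ν : Type} (ends : ε → Sym2 ν) (F : Finset ε) (u v : ν) : Prop :=
  ∃ p : MWalk ends u v, p.edgesIn F

/-- An edge set is acyclic (a forest) iff removing any one of its edges
disconnects the endpoints of that edge.  (In particular no loops and no
parallel pairs.) -/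
def IsAcyclic {ε ν : Type} [DecidableEq ε] (ends : ε → Sym2 ν) (F : Finset ε) : Prop :=
  ∀ e ∈ F, ∀ u v : ν, ends e = s(u, v) → ¬ Reachable ends (F.erase e) u v

/-- A spanning tree: an acyclic edge set connecting every pair of vertices. -/
def IsSpanningTree {ε ν : Type} [DecidableEq ε] (ends : ε → Sym2 ν) (T : Finset ε) : Prop :=
  IsAcyclic ends T ∧ ∀ u v : ν, Reachable ends T u v

/-! ### Biconed graphs -/

/-- The data of a biconed graph `G^{A,B}`:  the graph `G` has vertex set
`A ∪ B` with `A = Fin m`, `Ā = B \ A = Fin n`, `A ∩ B = S`, and abstract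
edge set `E` (so loops and parallel edges are allowed). -/
structure BiconedGraph where
  m : ℕ
  n : ℕ
  E : Type
  fintypeE : Fintype E
  decEqE : DecidableEq E
  ends : E → Sym2 (Fin m ⊕ₗ Fin n)
  S : Finset (Fin m)

namespace BiconedGraph

variable (P : BiconedGraph)

instance : Fintype P.E := P.fintypeE
instance : DecidableEq P.E := P.decEqE

/-- The vertices of `G`, linearly ordered `1 < ⋯ < m < 1̄ < ⋯ < n̄`. -/
abbrev VG := Fin P.m ⊕ₗ Fin P.n

/-- The vertices of `G^{A,B}_red`:  `⊥` is the vertex `0̄`, ordered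
`0̄ < 1 < ⋯ < m < 1̄ < ⋯ < n̄`. -/
abbrev Vred := WithBot P.VG

/-- The vertices of `G^{A,B}`: `⊥` is `0`, ordered `0 < 0̄ < 1 < ⋯ < n̄`. -/
abbrev W := WithBot P.Vred

/-- The vertex `a ∈ A`. -/
def aVert (a : Fin P.m) : P.VG := toLex (Sum.inl a)
/-- The vertex `b ∈ Ā`. -/
def bVert (b : Fin P.n) : P.VG := toLex (Sum.inr b)
/-- Inclusion of the vertices of `G` into those of `G^{A,B}_red`. -/
def liftV (x : P.VG) : P.Vred := (x : WithBot P.VG)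
/-- Inclusion of the vertices of `G^{A,B}_red` into those of `G^{A,B}`. -/
def liftW (x : P.Vred) : P.W := (x : WithBot P.Vred)

/-- The edges of the biconed graph `G^{A,B}`:  the edge `00̄`, the coning
edges `0a (a ∈ A)`, `0̄b (b ∈ Ā)`, `0̄a (a ∈ A ∩ B)`, and the edges of `G`. -/
abbrev EB := Unit ⊕ (Fin P.m ⊕ (Fin P.n ⊕ ({a : Fin P.m // a ∈ P.S} ⊕ P.E)))

/-- The edge `00̄`. -/
abbrev e00 : P.EB := Sum.inl ()
/-- The coning edge `0a`, `a ∈ A`. -/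
abbrev eA (a : Fin P.m) : P.EB := Sum.inr (Sum.inl a)
/-- The coning edge `0̄b`, `b ∈ Ā`. -/
abbrev eB (b : Fin P.n) : P.EB := Sum.inr (Sum.inr (Sum.inl b))
/-- The coning edge `0̄a`, `a ∈ A ∩ B`. -/
abbrev eS (a : {a : Fin P.m // a ∈ P.S}) : P.EB := Sum.inr (Sum.inr (Sum.inr (Sum.inl a)))
/-- An original edge of `G`. -/
abbrev eG (e : P.E) : P.EB := Sum.inr (Sum.inr (Sum.inr (Sum.inr e)))

/-- The endpoint map of `G^{A,B}`. -/
def endsB : P.EB → Sym2 P.W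
  | Sum.inl _ => s((⊥ : P.W), P.liftW ⊥)
  | Sum.inr (Sum.inl a) => s((⊥ : P.W), P.liftW (P.liftV (P.aVert a)))
  | Sum.inr (Sum.inr (Sum.inl b)) => s(P.liftW ⊥, P.liftW (P.liftV (P.bVert b)))
  | Sum.inr (Sum.inr (Sum.inr (Sum.inl a))) => s(P.liftW ⊥, P.liftW (P.liftV (P.aVert a.1)))
  | Sum.inr (Sum.inr (Sum.inr (Sum.inr e))) => (P.ends e).map fun x => P.liftW (P.liftV x)

/-- The spanning tree `T₀`, consisting of `00̄`, the edges `0a (a ∈ A)` and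
the edges `0̄b (b ∈ Ā)`. -/
def T0 : Finset P.EB :=
  Finset.univ.filter fun e => match e with
    | Sum.inl _ => True
    | Sum.inr (Sum.inl _) => True
    | Sum.inr (Sum.inr (Sum.inl _)) => True
    | _ => False

/-- The edges of `G^{A,B}_red` (delete the edges of `T₀` and the vertex `0`):
the edges `0̄a (a ∈ A ∩ B)` together with the edges of `G`. -/
abbrev Ered := {a : Fin P.m // a ∈ P.S} ⊕ P.E

/-- The endpoint map of `G^{A,B}_red`; `⊥` is the vertex `0̄`. -/
def endsRed : P.Ered → Sym2 P.Vred
  | Sum.inl a => s((⊥ : P.Vred), P.liftV (P.aVert a.1))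
  | Sum.inr e => (P.ends e).map P.liftV

/-- Inclusion of the edges of `G^{A,B}_red` into those of `G^{A,B}`. -/
def redToEB : P.Ered → P.EB
  | Sum.inl a => P.eS a
  | Sum.inr e => P.eG e

/-- The edge set `T \ T₀` of `T`, viewed inside `G^{A,B}_red`. -/
def redOf (T : Finset P.EB) : Finset P.Ered :=
  Finset.univ.filter fun e => P.redToEB e ∈ T

/-- `true` on the vertices of `A`, `false` on the vertices of `Ā ∪ {0̄}`. -/
def side : P.Vred → Bool :=
  WithBot.recBotCoe false fun x => Sum.elim (fun _ => true) (fun _ => false) (ofLex x)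

/-- The vertex lies in `A`. -/
def InA (v : P.Vred) : Prop := ∃ a : Fin P.m, v = P.liftV (P.aVert a)

/-- An edge of `G^{A,B}_red` is bridging if it joins a vertex of `A` to a
vertex of `Ā ∪ {0̄}`. -/
def BridgingE (e : P.Ered) : Prop :=
  ∃ u v : P.Vred, P.endsRed e = s(u, v) ∧ P.side u ≠ P.side v

/-! ### 2-edge-rooted forests -/

/-- The underlying edge set `F` of the multiset of edges given by the
multiplicity function `mult` (an edge `e` carries `mult e - 1` edge roots). -/
def mSupport (mult : P.Ered → ℕ) : Finset P.Ered :=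
  Finset.univ.filter fun e => mult e ≠ 0

/-- The degree of the multiset of edges given by `mult`. -/
def deg (mult : P.Ered → ℕ) : ℕ := ∑ e : P.Ered, mult e

/-- Edge `e` meets the connected component of `v` in the edge set `F`. -/
def Touches (F : Finset P.Ered) (v : P.Vred) (e : P.Ered) : Prop :=
  ∃ u : P.Vred, u ∈ P.endsRed e ∧ Reachable P.endsRed F v u

/-- The total number of edge roots in the component of `v`. -/
def compEdgeRoots (mult : P.Ered → ℕ) (v : P.Vred) : ℕ :=
  ∑ e ∈ P.mSupport mult, if P.Touches (P.mSupport mult) v e then mult e - 1 else 0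

/-- The component of `v` is `compCount`-edge-rooted:  the number of its edge
roots, plus `1` if it contains the vertex `0̄`. -/
def compCount (mult : P.Ered → ℕ) (v : P.Vred) : ℕ :=
  P.compEdgeRoots mult v +
    if Reachable P.endsRed (P.mSupport mult) v (⊥ : P.Vred) then 1 else 0

/-- Condition (C3) for the `2`-edge-rooted component of `v`:  the unique
shortest path containing both edge roots (resp. the vertex `0̄` and the edge
root, if the component contains `0̄`) has an odd number of bridging edges.
The shortest path containing two edges is the unique path whose first and
last edges are the two rooted edges; if the two edge roots lie on one common
edge (`mult e = 3`) the path is that single edge. -/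
def C3At (mult : P.Ered → ℕ) (v : P.Vred) : Prop :=
  (Reachable P.endsRed (P.mSupport mult) v (⊥ : P.Vred) →
    ∃ (x : P.Vred) (p : MWalk P.endsRed (⊥ : P.Vred) x),
      p.IsPath ∧ p.edgesIn (P.mSupport mult) ∧
      (∃ e, p.edges.getLast? = some e ∧ 2 ≤ mult e) ∧
      Odd (p.bridgeCount P.side)) ∧
  (¬ Reachable P.endsRed (P.mSupport mult) v (⊥ : P.Vred) →
    ∃ (x y : P.Vred) (p : MWalk P.endsRed x y),
      p.IsPath ∧ p.edgesIn (P.mSupport mult) ∧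
      Reachable P.endsRed (P.mSupport mult) v x ∧
      (∃ e, p.edges.head? = some e ∧ 2 ≤ mult e) ∧
      (∃ e, p.edges.getLast? = some e ∧ 2 ≤ mult e) ∧
      (∀ e, p.edges = [e] → mult e = 3) ∧
      Odd (p.bridgeCount P.side))

/-- `mult : Ered → ℕ` is (the multiplicity function of) a 2-edge-rooted
forest of `G^{A,B}_red`:
(C0) its support is a spanning forest;
(C1) at most one component is `2`-edge-rooted;
(C2) every other component is `0`- or `1`-edge-rooted;
(C3) the parity condition on the path joining the two roots. -/
def Is2ERF (mult : P.Ered → ℕ) : Prop :=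
  IsAcyclic P.endsRed (P.mSupport mult) ∧
  (∀ v : P.Vred, P.compCount mult v ≤ 2) ∧
  (∀ u v : P.Vred, P.compCount mult u = 2 → P.compCount mult v = 2 →
    Reachable P.endsRed (P.mSupport mult) u v) ∧
  (∀ v : P.Vred, P.compCount mult v = 2 → P.C3At mult v)

/-! ### Birooted forests -/

/-- `(F, R)` is a birooted forest of `G^{A,B}_red`:  `F` is a spanning forest,
the root set `R` contains `0̄`, every component of `F` contains at least one
root, no component contains three roots, at most one component contains two
roots, and a component with two roots has one root in `A` and the other in
`Ā ∪ {0̄}`. -/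
def IsBirootedForest (F : Finset P.Ered) (R : Set P.Vred) : Prop :=
  IsAcyclic P.endsRed F ∧
  (⊥ : P.Vred) ∈ R ∧
  (∀ v : P.Vred, ∃ r ∈ R, Reachable P.endsRed F v r) ∧
  (∀ r₁ ∈ R, ∀ r₂ ∈ R, ∀ r₃ ∈ R, r₁ ≠ r₂ → r₁ ≠ r₃ → r₂ ≠ r₃ →
    Reachable P.endsRed F r₁ r₂ → Reachable P.endsRed F r₁ r₃ → False) ∧
  (∀ r₁ ∈ R, ∀ r₂ ∈ R, ∀ r₃ ∈ R, ∀ r₄ ∈ R, r₁ ≠ r₂ → r₃ ≠ r₄ →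
    Reachable P.endsRed F r₁ r₂ → Reachable P.endsRed F r₃ r₄ →
    Reachable P.endsRed F r₁ r₃) ∧
  (∀ r₁ ∈ R, ∀ r₂ ∈ R, r₁ ≠ r₂ → Reachable P.endsRed F r₁ r₂ →
    (P.InA r₁ ∧ ¬ P.InA r₂) ∨ (P.InA r₂ ∧ ¬ P.InA r₁))

/-! ### Internal activity and the edge order -/

/-- `e` is internally passive in the spanning tree `T`:  it can be exchanged
for a strictly smaller edge `f` so that the result is again a spanning tree. -/
def InternallyPassive (ord : LinearOrder P.EB) (T : Finset P.EB) (e : P.EB) : Prop :=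
  e ∈ T ∧ ∃ f : P.EB, ord.lt f e ∧ IsSpanningTree P.endsB (insert f (T.erase e))

/-- `e` is internally active in the spanning tree `T`. -/
def InternallyActive (ord : LinearOrder P.EB) (T : Finset P.EB) (e : P.EB) : Prop :=
  e ∈ T ∧ ¬ ∃ f : P.EB, ord.lt f e ∧ IsSpanningTree P.endsB (insert f (T.erase e))

/-- The number of internally passive edges of `T`. -/
def ipCount (ord : LinearOrder P.EB) (T : Finset P.EB) : ℕ :=
  (T.filter fun e => P.InternallyPassive ord T e).card

/-- The smaller endpoint of an edge of `G^{A,B}`. -/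
def endMin (e : P.EB) : P.W := Sym2.lift ⟨fun a b => a ⊓ b, fun a b => inf_comm a b⟩ (P.endsB e)
/-- The larger endpoint of an edge of `G^{A,B}`. -/
def endMax (e : P.EB) : P.W := Sym2.lift ⟨fun a b => a ⊔ b, fun a b => sup_comm a b⟩ (P.endsB e)

/-- The endpoints of an edge, as an ordered pair in the lexicographic square
of the vertex order `0 < 0̄ < 1 < ⋯ < m < 1̄ < ⋯ < n̄`. -/
def lexEnds (e : P.EB) : P.W ×ₗ P.W := toLex (P.endMin e, P.endMax e)

/-- A linear order on the edges of `G^{A,B}` is admissible if it refines the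
lexicographic order on endpoints (so parallel edges are ordered arbitrarily). -/
def AdmissibleOrder (ord : LinearOrder P.EB) : Prop :=
  ∀ e f : P.EB, P.lexEnds e < P.lexEnds f → ord.lt e f

/-- `v` is a connecting vertex of `T`:  `v ∈ A` and `v` is adjacent to `0` in
`T`, or `v ∈ Ā` and `v` is adjacent to `0̄` in `T`. -/
def ConnVertex (T : Finset P.EB) (v : P.Vred) : Prop :=
  (∃ a : Fin P.m, v = P.liftV (P.aVert a) ∧ P.eA a ∈ T) ∨
  (∃ b : Fin P.n, v = P.liftV (P.bVert b) ∧ P.eB b ∈ T)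

/-- `e` is a connecting edge of `T` (an edge `0a`, `a ∈ A`, or `0̄b`, `b ∈ Ā`)
with connecting vertex `v`. -/
def ConnEdge (T : Finset P.EB) (e : P.EB) (v : P.Vred) : Prop :=
  e ∈ T ∧ ((∃ a : Fin P.m, e = P.eA a ∧ v = P.liftV (P.aVert a)) ∨
           (∃ b : Fin P.n, e = P.eB b ∧ v = P.liftV (P.bVert b)))

/-! ### The h-vector -/

/-- `f_{i-1}`:  the number of acyclic edge sets of cardinality `i` in `G^{A,B}`. -/
def numAcyclic (i : ℕ) : ℕ :=
  Nat.card {F : Finset P.EB // IsAcyclic P.endsB F ∧ F.card = i}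

/-- The rank of the graphic matroid of `G^{A,B}`:  `|V| - 1 = m + n + 1`. -/
def d : ℕ := P.m + P.n + 1

/-- `h` is the h-vector of the graphic matroid of `G^{A,B}`:  it satisfies
`Σ_{i=0}^{d} f_{i-1} (t-1)^{d-i} = Σ_{k=0}^{d} h_k t^{d-k}`. -/
def IsHVector (h : ℕ → ℤ) : Prop :=
  ∑ i ∈ Finset.range (P.d + 1),
      Polynomial.C ((P.numAcyclic i : ℤ)) * (Polynomial.X - 1) ^ (P.d - i)
    = ∑ k ∈ Finset.range (P.d + 1), Polynomial.C (h k) * Polynomial.X ^ (P.d - k)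

end BiconedGraph

/-- `(h 0, …, h d)` is a pure O-sequence:  there is a multicomplex `M` of
multisets on a finite ground set (nonempty, closed under sub-multisets), all
of whose inclusion-maximal members have the same cardinality, whose members
all have cardinality at most `d`, and which has exactly `h i` members of
cardinality `i` for every `i ≤ d`. -/
def IsPureOSeq (d : ℕ) (h : ℕ → ℤ) : Prop :=
  ∃ (N : ℕ) (M : Set (Multiset (Fin N))),
    M.Nonempty ∧
    (∀ s ∈ M, ∀ t : Multiset (Fin N), t ≤ s → t ∈ M) ∧
    (∀ s ∈ M, ∀ t ∈ M, (∀ u ∈ M, s ≤ u → u = s) → (∀ u ∈ M, t ≤ u → u = t) →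
      Multiset.card s = Multiset.card t) ∧
    (∀ s ∈ M, Multiset.card s ≤ d) ∧
    (∀ i ≤ d, (Nat.card {s : Multiset (Fin N) // s ∈ M ∧ Multiset.card s = i} : ℤ) = h i)


/-! ### Generic lemmas on multigraphs -/

section Generic

variable {ε ν : Type} {ends : ε → Sym2 ν}

theorem Reachable.refl (F : Finset ε) (u : ν) : Reachable ends F u u :=
  ⟨MWalk.nil u, by intro e he; simp [MWalk.edges] at he⟩

theorem Reachable.cons {F : Finset ε} {u v w : ν} {e : ε} (he : e ∈ F) (h : ends e = s(u, v))
    (hr : Reachable ends F v w) : Reachable ends F u w := by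
  obtain ⟨p, hp⟩ := hr
  refine ⟨MWalk.cons e v h p, ?_⟩
  intro g hg
  simp only [MWalk.edges, List.mem_cons] at hg
  rcases hg with rfl | hg
  · exact he
  · exact hp g hg

theorem Reachable.edge {F : Finset ε} {u v : ν} {e : ε} (he : e ∈ F) (h : ends e = s(u, v)) :
    Reachable ends F u v := Reachable.cons he h (Reachable.refl F v)

theorem Reachable.ind {F : Finset ε} {w : ν} {motive : ν → Prop} (hnil : motive w)
    (hcons : ∀ u v e, e ∈ F → ends e = s(u, v) → Reachable ends F v w → motive v → motive u)
    {u : ν} (h : Reachable ends F u w) : motive u := by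
  obtain ⟨p, hp⟩ := h
  induction p with
  | nil u => exact hnil
  | cons e v h p ih =>
    have hp' : p.edgesIn F := fun g hg => hp g (by simp [MWalk.edges, hg])
    exact hcons _ v e (hp e (by simp [MWalk.edges])) h ⟨p, hp'⟩ (ih hnil hcons hp')

theorem Reachable.trans {F : Finset ε} {u v w : ν} (h₁ : Reachable ends F u v)
    (h₂ : Reachable ends F v w) : Reachable ends F u w :=
  Reachable.ind (motive := fun x => Reachable ends F x w) h₂
    (fun _ _ _ he h _ ih => Reachable.cons he h ih) h₁

theorem Reachable.symm {F : Finset ε} {u v : ν} (h : Reachable ends F u v) :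
    Reachable ends F v u :=
  Reachable.ind (motive := fun x => Reachable ends F v x) (Reachable.refl F v)
    (fun a b e he h _ ih => ih.trans (Reachable.edge he (by rw [h, Sym2.eq_swap]))) h

theorem Reachable.mono {F F' : Finset ε} (hF : F ⊆ F') {u v : ν} (h : Reachable ends F u v) :
    Reachable ends F' u v := by
  obtain ⟨p, hp⟩ := h
  exact ⟨p, fun e he => hF (hp e he)⟩

theorem Reachable.of_mem {F : Finset ε} {e : ε} (he : e ∈ F) {u v : ν} (hu : u ∈ ends e)
    (hv : v ∈ ends e) : Reachable ends F u v := by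
  by_cases huv : u = v
  · subst huv; exact Reachable.refl F u
  · exact Reachable.edge he ((Sym2.mem_and_mem_iff huv).1 ⟨hu, hv⟩)

theorem Reachable.insert_cases [DecidableEq ε] {F : Finset ε} {e : ε} {u w x y : ν}
    (he : ends e = s(u, w)) (h : Reachable ends (insert e F) x y) :
    Reachable ends F x y ∨ (Reachable ends F x u ∧ Reachable ends F w y) ∨
      (Reachable ends F x w ∧ Reachable ends F u y) := by
  refine Reachable.ind (motive := fun x => Reachable ends F x y ∨
    (Reachable ends F x u ∧ Reachable ends F w y) ∨
      (Reachable ends F x w ∧ Reachable ends F u y)) (Or.inl (Reachable.refl F y)) ?_ h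
  intro a b g hg hab _ ih
  rcases Finset.mem_insert.1 hg with rfl | hg
  · rw [he] at hab
    rcases Sym2.eq_iff.1 hab with ⟨rfl, rfl⟩ | ⟨rfl, rfl⟩
    · rcases ih with ih | ⟨h1, h2⟩ | ⟨h1, h2⟩
      · exact Or.inr (Or.inl ⟨Reachable.refl F _, ih⟩)
      · exact Or.inr (Or.inl ⟨Reachable.refl F _, h2⟩)
      · exact Or.inl h2
    · rcases ih with ih | ⟨h1, h2⟩ | ⟨h1, h2⟩
      · exact Or.inr (Or.inr ⟨Reachable.refl F _, ih⟩)
      · exact Or.inl h2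
      · exact Or.inr (Or.inr ⟨Reachable.refl F _, h2⟩)
  · have hr := Reachable.edge hg hab
    rcases ih with ih | ⟨h1, h2⟩ | ⟨h1, h2⟩
    · exact Or.inl (hr.trans ih)
    · exact Or.inr (Or.inl ⟨hr.trans h1, h2⟩)
    · exact Or.inr (Or.inr ⟨hr.trans h1, h2⟩)

theorem IsAcyclic.mono [DecidableEq ε] {F F' : Finset ε} (hF : F ⊆ F')
    (h : IsAcyclic ends F') : IsAcyclic ends F :=
  fun e he u v huv hr => h e (hF he) u v huv (hr.mono (Finset.erase_subset_erase e hF))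

theorem IsAcyclic.insert_edge [DecidableEq ε] {F : Finset ε} {e : ε} {u w : ν}
    (hF : IsAcyclic ends F) (he : ends e = s(u, w)) (hr : ¬ Reachable ends F u w) :
    IsAcyclic ends (insert e F) := by
  have heF : e ∉ F := fun h => hr (Reachable.edge h he)
  intro g hg a b hab hab'
  by_cases hge : g = e
  · subst hge
    rw [Finset.erase_insert heF] at hab'
    rw [he] at hab
    rcases Sym2.eq_iff.1 hab with ⟨rfl, rfl⟩ | ⟨rfl, rfl⟩
    · exact hr hab'
    · exact hr hab'.symm
  · have hgF : g ∈ F := (Finset.mem_insert.1 hg).resolve_left hge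
    rw [Finset.erase_insert_of_ne (Ne.symm hge)] at hab'
    have hs : F.erase g ⊆ F := Finset.erase_subset _ _
    have hg' := Reachable.edge hgF hab
    rcases Reachable.insert_cases he hab' with h | ⟨h1, h2⟩ | ⟨h1, h2⟩
    · exact hF g hgF a b hab h
    · exact hr (((h1.mono hs).symm.trans hg').trans (h2.mono hs).symm)
    · exact hr (((h2.mono hs).trans hg'.symm).trans (h1.mono hs))

theorem IsAcyclic.not_loop [DecidableEq ε] {F : Finset ε} (hF : IsAcyclic ends F) {e : ε}
    (he : e ∈ F) {u v : ν} (h : ends e = s(u, v)) : u ≠ v := by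
  rintro rfl
  exact hF e he u u h (Reachable.refl _ _)

/-! Paths -/

theorem MWalk.start_mem_support {u v : ν} (p : MWalk ends u v) : u ∈ p.support := by
  cases p <;> simp [MWalk.support]

theorem MWalk.end_mem_support {u v : ν} (p : MWalk ends u v) : v ∈ p.support := by
  induction p with
  | nil u => simp [MWalk.support]
  | cons e v h p ih => simp [MWalk.support, ih]

theorem MWalk.exists_path_from {v w : ν} (q : MWalk ends v w) (hq : q.IsPath) {u : ν}
    (hu : u ∈ q.support) : ∃ p : MWalk ends u w, p.IsPath ∧ ∀ e ∈ p.edges, e ∈ q.edges := by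
  induction q with
  | nil x =>
    simp only [MWalk.support, List.mem_singleton] at hu
    subst hu
    exact ⟨MWalk.nil u, hq, fun e he => he⟩
  | @cons a b e x h q ih =>
    simp only [MWalk.support, List.mem_cons] at hu
    rcases hu with rfl | hu
    · exact ⟨MWalk.cons e x h q, hq, fun e he => he⟩
    · have hq' : q.IsPath := by
        simp only [MWalk.IsPath, MWalk.support, List.nodup_cons] at hq
        exact hq.2
      obtain ⟨p, hp, hpe⟩ := ih hq' hu
      exact ⟨p, hp, fun g hg => by simp [MWalk.edges, hpe g hg]⟩

theorem Reachable.exists_path {F : Finset ε} {u w : ν} (h : Reachable ends F u w) :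
    ∃ p : MWalk ends u w, p.IsPath ∧ p.edgesIn F := by
  refine Reachable.ind (motive := fun x => ∃ p : MWalk ends x w, p.IsPath ∧ p.edgesIn F)
    ⟨MWalk.nil w, by simp [MWalk.IsPath, MWalk.support], by intro e he; simp [MWalk.edges] at he⟩
    ?_ h
  rintro a b e he hab - ⟨p, hp, hpF⟩
  by_cases ha : a ∈ p.support
  · obtain ⟨q, hq, hqe⟩ := p.exists_path_from hp ha
    exact ⟨q, hq, fun g hg => hpF g (hqe g hg)⟩
  · refine ⟨MWalk.cons e b hab p, ?_, ?_⟩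
    · simp only [MWalk.IsPath, MWalk.support, List.nodup_cons]
      exact ⟨ha, hp⟩
    · intro g hg
      simp only [MWalk.edges, List.mem_cons] at hg
      rcases hg with rfl | hg
      · exact he
      · exact hpF g hg

theorem MWalk.exists_snoc {u v : ν} (p : MWalk ends u v) {w : ν} (e : ε) (h : ends e = s(v, w)) :
    ∃ q : MWalk ends u w, q.edges = p.edges ++ [e] ∧ q.support = p.support ++ [w] := by
  induction p with
  | nil u => exact ⟨MWalk.cons e w h (MWalk.nil w), by simp [MWalk.edges], by simp [MWalk.support]⟩
  | cons g x hg p ih =>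
    obtain ⟨q, hq1, hq2⟩ := ih h
    exact ⟨MWalk.cons g x hg q, by simp [MWalk.edges, hq1], by simp [MWalk.support, hq2]⟩

theorem MWalk.reachable_of_mem_support {F : Finset ε} {u v : ν} (p : MWalk ends u v)
    (hp : p.edgesIn F) {x : ν} (hx : x ∈ p.support) : Reachable ends F u x := by
  induction p with
  | nil u =>
    simp only [MWalk.support, List.mem_singleton] at hx
    subst hx; exact Reachable.refl F _
  | cons e b h p ih =>
    simp only [MWalk.support, List.mem_cons] at hx
    rcases hx with rfl | hx
    · exact Reachable.refl F _
    · exact Reachable.cons (hp e (by simp [MWalk.edges])) h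
        (ih (fun g hg => hp g (by simp [MWalk.edges, hg])) hx)

theorem MWalk.mem_support_of_mem_edges {u v : ν} (p : MWalk ends u v) {e : ε} (he : e ∈ p.edges)
    {x : ν} (hx : x ∈ ends e) : x ∈ p.support := by
  induction p with
  | nil u => simp [MWalk.edges] at he
  | cons g b h p ih =>
    simp only [MWalk.edges, List.mem_cons] at he
    simp only [MWalk.support, List.mem_cons]
    rcases he with rfl | he
    · rw [h, Sym2.mem_iff] at hx
      rcases hx with rfl | rfl
      · exact Or.inl rfl
      · exact Or.inr p.start_mem_support
    · exact Or.inr (ih he)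

theorem MWalk.end_mem_last {u v : ν} (p : MWalk ends u v) {e : ε}
    (he : p.edges.getLast? = some e) : v ∈ ends e := by
  induction p with
  | nil u => simp [MWalk.edges] at he
  | cons g b h p ih =>
    cases p with
    | nil =>
      simp only [MWalk.edges, List.getLast?_singleton, Option.some.injEq] at he
      subst he; rw [h]; simp
    | cons g' b' h' p' =>
      apply ih
      simpa [MWalk.edges, List.getLast?_cons_cons] using he

theorem MWalk.start_mem_head {u v : ν} (p : MWalk ends u v) {e : ε}
    (he : p.edges.head? = some e) : u ∈ ends e := by
  cases p with
  | nil => simp [MWalk.edges] at he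
  | cons g b h p =>
    simp only [MWalk.edges, List.head?_cons, Option.some.injEq] at he
    subst he; rw [h]; simp

/-- a path from `v` whose last edge is `f` -/
theorem IsAcyclic.path_to_edge [DecidableEq ε] {F : Finset ε} (hF : IsAcyclic ends F) {f : ε}
    (hf : f ∈ F) {v a : ν} (ha : a ∈ ends f) (hv : Reachable ends F v a) :
    ∃ (y : ν) (p : MWalk ends v y) (l : List ε), p.IsPath ∧ p.edgesIn F ∧
      p.edges = l ++ [f] ∧ f ∉ l := by
  obtain ⟨b, hb⟩ := Sym2.mem_iff_exists.1 ha
  have key : ∃ a' b', ends f = s(a', b') ∧ Reachable ends (F.erase f) v a' := by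
    have h' : Reachable ends (Insert.insert f (F.erase f)) v a := by
      rwa [Finset.insert_erase hf]
    rcases Reachable.insert_cases hb h' with h | ⟨h1, h2⟩ | ⟨h1, h2⟩
    · exact ⟨a, b, hb, h⟩
    · exact ⟨a, b, hb, h1⟩
    · exact ⟨b, a, by rw [hb, Sym2.eq_swap], h1⟩
  obtain ⟨a', b', hab, hr⟩ := key
  obtain ⟨p, hp, hpF⟩ := hr.exists_path
  obtain ⟨q, hq1, hq2⟩ := p.exists_snoc f hab
  refine ⟨b', q, p.edges, ?_, ?_, hq1, ?_⟩
  · rw [MWalk.IsPath, hq2, List.nodup_append]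
    refine ⟨hp, by simp, ?_⟩
    intro x hx y hy
    simp only [List.mem_singleton] at hy
    subst hy
    rintro rfl
    exact hF f hf _ _ hab (hr.symm.trans (p.reachable_of_mem_support hpF hx))
  · intro g hg
    rw [hq1, List.mem_append] at hg
    rcases hg with hg | hg
    · exact Finset.mem_of_mem_erase (hpF g hg)
    · simp only [List.mem_singleton] at hg; subst hg; exact hf
  · intro h
    exact (Finset.notMem_erase f F) (hpF f h)

/-- a path with prescribed distinct first and last edges -/
theorem IsAcyclic.path_two_edges [DecidableEq ε] {F : Finset ε} (hF : IsAcyclic ends F)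
    {f₁ f₂ : ε} (hf₁ : f₁ ∈ F) (hf₂ : f₂ ∈ F) (hne : f₁ ≠ f₂) {a₁ a₂ : ν} (ha₁ : a₁ ∈ ends f₁)
    (ha₂ : a₂ ∈ ends f₂) (hr : Reachable ends F a₁ a₂) :
    ∃ (x y : ν) (p : MWalk ends x y), p.IsPath ∧ p.edgesIn F ∧ p.edges.head? = some f₁ ∧
      p.edges.getLast? = some f₂ := by
  obtain ⟨y, p, l, hp, hpF, hpe, -⟩ := hF.path_to_edge hf₂ ha₂ hr
  have hlast : p.edges.getLast? = some f₂ := by simp [hpe]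
  obtain ⟨b, hb⟩ := Sym2.mem_iff_exists.1 ha₁
  by_cases hmem : f₁ ∈ p.edges
  · refine ⟨a₁, y, p, hp, hpF, ?_, hlast⟩
    cases p with
    | nil => simp [MWalk.edges] at hmem
    | cons g c h p =>
      simp only [MWalk.edges, List.mem_cons] at hmem
      rcases hmem with rfl | hmem
      · simp [MWalk.edges]
      · exfalso
        simp only [MWalk.IsPath, MWalk.support, List.nodup_cons] at hp
        exact hp.1 (p.mem_support_of_mem_edges hmem ha₁)
  · refine ⟨b, y, MWalk.cons f₁ a₁ (by rw [hb, Sym2.eq_swap]) p, ?_, ?_, ?_, ?_⟩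
    · simp only [MWalk.IsPath, MWalk.support, List.nodup_cons]
      refine ⟨fun hbs => ?_, hp⟩
      refine hF f₁ hf₁ _ _ hb (p.reachable_of_mem_support ?_ hbs)
      intro g hg
      exact Finset.mem_erase.2 ⟨fun h => hmem (h ▸ hg), hpF g hg⟩
    · intro g hg
      simp only [MWalk.edges, List.mem_cons] at hg
      rcases hg with rfl | hg
      · exact hf₁
      · exact hpF g hg
    · simp [MWalk.edges]
    · simp [MWalk.edges, hpe, List.getLast?_cons]

theorem MWalk.odd_bridgeCount (s : ν → Bool) {u v : ν} (p : MWalk ends u v) :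
    Odd (p.bridgeCount s) ↔ s u ≠ s v := by
  induction p with
  | nil u => simp [MWalk.bridgeCount]
  | @cons a b e x h p ih =>
    simp only [MWalk.bridgeCount]
    rw [Nat.odd_add', ih]
    by_cases hab : s a = s x
    · simp [hab]
    · simp only [hab, if_false]
      cases ha : s a <;> cases hx : s x <;> cases hb : s b <;> simp_all

theorem MWalk.exists_bridge (s : ν → Bool) {u v : ν} (p : MWalk ends u v) (h : s u ≠ s v) :
    ∃ e ∈ p.edges, ∃ a b, ends e = s(a, b) ∧ s a ≠ s b := by
  induction p with
  | nil u => exact absurd rfl h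
  | @cons a b e x he p ih =>
    by_cases hab : s a = s x
    · obtain ⟨g, hg, h'⟩ := ih (by rwa [← hab])
      exact ⟨g, by simp [MWalk.edges, hg], h'⟩
    · exact ⟨e, by simp [MWalk.edges], a, x, he, hab⟩

/-! Counting components -/

/-- The component setoid. -/
def reachSetoid (ends : ε → Sym2 ν) (F : Finset ε) : Setoid ν where
  r := Reachable ends F
  iseqv := ⟨Reachable.refl F, Reachable.symm, Reachable.trans⟩

theorem mk_eq_iff (F : Finset ε) (u v : ν) :
    (Quotient.mk (reachSetoid ends F) u = Quotient.mk (reachSetoid ends F) v) ↔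
      Reachable ends F u v := Quotient.eq (r := reachSetoid ends F)

theorem IsAcyclic.card_add [Fintype ν] [DecidableEq ε] {F : Finset ε} (hF : IsAcyclic ends F) :
    Fintype.card (Quotient (reachSetoid ends F)) + F.card = Fintype.card ν := by
  induction F using Finset.induction_on with
  | empty =>
    rw [Finset.card_empty, add_zero]
    symm
    refine Fintype.card_of_bijective (f := Quotient.mk (reachSetoid ends (∅ : Finset ε)))
      ⟨?_, Quotient.mk_surjective⟩
    intro u v huv
    rw [mk_eq_iff] at huv
    refine Reachable.ind (motive := fun x => x = v) rfl ?_ huv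
    intro a b e he
    simp at he
  | insert e F heF ih =>
    have hF' := hF.mono (Finset.subset_insert e F)
    obtain ⟨⟨u, w⟩, he⟩ := Quot.exists_rep (ends e)
    replace he : ends e = s(u, w) := he.symm
    have hr : ¬ Reachable ends F u w := by
      have := hF e (Finset.mem_insert_self e F) u w he
      rwa [Finset.erase_insert heF] at this
    have hew : Reachable ends (insert e F) u w := Reachable.edge (Finset.mem_insert_self e F) he
    rw [← ih hF', Finset.card_insert_of_notMem heF]
    let f : {q : Quotient (reachSetoid ends F) // q ≠ Quotient.mk _ u} →
        Quotient (reachSetoid ends (insert e F)) := fun q => Quotient.mk _ q.1.out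
    have hbij : Function.Bijective f := by
      constructor
      · rintro ⟨q₁, h₁⟩ ⟨q₂, h₂⟩ h
        have h' := (mk_eq_iff _ _ _).1 h
        simp only at h'
        rw [Subtype.mk.injEq, ← Quotient.out_eq q₁, ← Quotient.out_eq q₂, mk_eq_iff]
        rw [← Quotient.out_eq q₁, ne_eq, mk_eq_iff] at h₁
        rw [← Quotient.out_eq q₂, ne_eq, mk_eq_iff] at h₂
        rcases Reachable.insert_cases he h' with h | ⟨h3, h4⟩ | ⟨h3, h4⟩
        · exact h
        · exact absurd h3 h₁
        · exact absurd h4.symm h₂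
      · intro q
        induction q using Quotient.inductionOn with
        | h x =>
        have hsub := Finset.subset_insert e F
        by_cases hx : Reachable ends F x u
        · refine ⟨⟨Quotient.mk _ w, ?_⟩, ?_⟩
          · rw [ne_eq, mk_eq_iff]; exact fun h => hr h.symm
          · refine (mk_eq_iff _ _ _).2 ?_
            have := (mk_eq_iff F _ w).1 (Quotient.out_eq (Quotient.mk (reachSetoid ends F) w))
            exact (this.mono hsub).trans (hew.symm.trans (hx.symm.mono hsub))
        · refine ⟨⟨Quotient.mk _ x, ?_⟩, ?_⟩
          · rw [ne_eq, mk_eq_iff]; exact hx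
          · refine (mk_eq_iff _ _ _).2 ?_
            have := (mk_eq_iff F _ x).1 (Quotient.out_eq (Quotient.mk (reachSetoid ends F) x))
            exact this.mono hsub
    have h1 := Fintype.card_of_bijective hbij
    have h2 := Fintype.card_subtype_compl
      (fun q : Quotient (reachSetoid ends F) => q = Quotient.mk _ u)
    have h3 : Fintype.card {q : Quotient (reachSetoid ends F) // q = Quotient.mk _ u} = 1 :=
      Fintype.card_subtype_eq _
    have h4 : 0 < Fintype.card (Quotient (reachSetoid ends F)) :=
      Fintype.card_pos_iff.2 ⟨Quotient.mk _ u⟩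
    have h5 : Fintype.card {q : Quotient (reachSetoid ends F) // q ≠ Quotient.mk _ u} =
      Fintype.card {q : Quotient (reachSetoid ends F) // ¬ q = Quotient.mk _ u} := rfl
    omega

end Generic

namespace BiconedGraph

variable {P : BiconedGraph}

/-- A representative endpoint of an edge. -/
def rep (P : BiconedGraph) (e : P.Ered) : P.Vred := (Quot.out (P.endsRed e)).1

theorem rep_mem (e : P.Ered) : P.rep e ∈ P.endsRed e := Sym2.out_fst_mem _

theorem mem_mSupport {m : P.Ered → ℕ} {e : P.Ered} : e ∈ P.mSupport m ↔ m e ≠ 0 := by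
  simp [mSupport]

theorem touches_iff {F : Finset P.Ered} {e : P.Ered} (he : e ∈ F) {a : P.Vred}
    (ha : a ∈ P.endsRed e) (v : P.Vred) :
    P.Touches F v e ↔ Reachable P.endsRed F v a := by
  constructor
  · rintro ⟨u, hu, hr⟩
    exact hr.trans (Reachable.of_mem he hu ha)
  · intro h
    exact ⟨a, ha, h⟩

theorem compCount_eq (m : P.Ered → ℕ) (v : P.Vred) :
    P.compCount m v = (∑ e, if Reachable P.endsRed (P.mSupport m) v (P.rep e) then m e - 1 else 0)
      + if Reachable P.endsRed (P.mSupport m) v (⊥ : P.Vred) then 1 else 0 := by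
  rw [compCount, compEdgeRoots]
  congr 1
  rw [← Finset.sum_subset (Finset.subset_univ (P.mSupport m))]
  · refine Finset.sum_congr rfl fun e he => ?_
    simp only [touches_iff he (rep_mem e)]
  · intro e _ he
    rw [mem_mSupport, not_not] at he
    simp [he]

theorem compCount_congr {m : P.Ered → ℕ} {u v : P.Vred}
    (h : Reachable P.endsRed (P.mSupport m) u v) : P.compCount m u = P.compCount m v := by
  have h' : ∀ a, Reachable P.endsRed (P.mSupport m) u a ↔
      Reachable P.endsRed (P.mSupport m) v a := fun a => ⟨h.symm.trans, h.trans⟩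
  simp only [compCount_eq, h']

theorem C3At_congr {m : P.Ered → ℕ} {u v : P.Vred}
    (h : Reachable P.endsRed (P.mSupport m) u v) (hc : P.C3At m u) : P.C3At m v := by
  refine ⟨fun hb => hc.1 (h.trans hb), fun hb => ?_⟩
  obtain ⟨x, y, p, h1, h2, h3, h4⟩ := hc.2 (fun h' => hb (h.symm.trans h'))
  exact ⟨x, y, p, h1, h2, h.symm.trans h3, h4⟩

theorem C3At_mono {m m' : P.Ered → ℕ} (hm : ∀ e, m e ≤ m' e) {v : P.Vred}
    (hb : Reachable P.endsRed (P.mSupport m') v (⊥ : P.Vred) →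
      Reachable P.endsRed (P.mSupport m) v (⊥ : P.Vred))
    (heq : ∀ e, m e ≠ 0 → P.Touches (P.mSupport m) v e → m' e = m e)
    (hc : P.C3At m v) : P.C3At m' v := by
  have hs : P.mSupport m ⊆ P.mSupport m' := by
    intro e he
    rw [mem_mSupport] at he ⊢
    have := hm e
    omega
  constructor
  · intro h
    obtain ⟨x, p, h1, h2, ⟨e, h3, h3'⟩, h4⟩ := hc.1 (hb h)
    exact ⟨x, p, h1, fun g hg => hs (h2 g hg), ⟨e, h3, h3'.trans (hm e)⟩, h4⟩
  · intro h
    obtain ⟨x, y, p, h1, h2, h3, ⟨e, h4, h4'⟩, ⟨f, h5, h5'⟩, h6, h7⟩ :=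
      hc.2 (fun h' => h (h'.mono hs))
    refine ⟨x, y, p, h1, fun g hg => hs (h2 g hg), h3.mono hs, ⟨e, h4, h4'.trans (hm e)⟩,
      ⟨f, h5, h5'.trans (hm f)⟩, ?_, h7⟩
    intro g hg
    have hge : g = e := by
      rw [hg] at h4
      simpa using h4
    subst hge
    rw [heq g (by omega) ⟨x, p.start_mem_head h4, h3⟩]
    exact h6 g hg

/-! Adding a root -/

/-- Increase the multiplicity of `f` by one. -/
def addRoot (m : P.Ered → ℕ) (f : P.Ered) : P.Ered → ℕ := fun e => if e = f then m e + 1 else m e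

theorem le_addRoot (m : P.Ered → ℕ) (f e : P.Ered) : m e ≤ addRoot m f e := by
  unfold addRoot; split_ifs <;> omega

theorem addRoot_self (m : P.Ered → ℕ) (f : P.Ered) : addRoot m f f = m f + 1 := by
  simp [addRoot]

theorem supp_addRoot {m : P.Ered → ℕ} {f : P.Ered} (hf : f ∈ P.mSupport m) :
    P.mSupport (addRoot m f) = P.mSupport m := by
  ext e
  rw [mem_mSupport] at *
  rw [mem_mSupport]
  unfold addRoot
  split_ifs with h
  · subst h; simp [hf]
  · rfl

theorem compCount_addRoot {m : P.Ered → ℕ} {f : P.Ered} (hf : f ∈ P.mSupport m) (v : P.Vred) :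
    P.compCount (addRoot m f) v = P.compCount m v +
      if Reachable P.endsRed (P.mSupport m) v (P.rep f) then 1 else 0 := by
  rw [compCount_eq, compCount_eq, supp_addRoot hf]
  have key : ∀ e, (if Reachable P.endsRed (P.mSupport m) v (P.rep e) then addRoot m f e - 1 else 0)
      = (if Reachable P.endsRed (P.mSupport m) v (P.rep e) then m e - 1 else 0) +
        if e = f then (if Reachable P.endsRed (P.mSupport m) v (P.rep f) then 1 else 0) else 0 := by
    intro e
    by_cases he : e = f
    · subst he
      rw [mem_mSupport] at hf
      simp only [addRoot_self, if_true]
      split_ifs <;> omega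
    · simp [addRoot, he]
  rw [Finset.sum_congr rfl fun e _ => key e, Finset.sum_add_distrib, Finset.sum_ite_eq']
  simp only [Finset.mem_univ, if_true]
  omega

theorem Is2ERF_addRoot_zero {m : P.Ered → ℕ} (h : P.Is2ERF m) {f : P.Ered}
    (hf : f ∈ P.mSupport m) (h0 : P.compCount m (P.rep f) = 0) : P.Is2ERF (addRoot m f) := by
  have hc := compCount_addRoot hf
  have key : ∀ v, P.compCount (addRoot m f) v = 2 → P.compCount m v = 2 ∧
      ¬ Reachable P.endsRed (P.mSupport m) v (P.rep f) := by
    intro v hv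
    rw [hc] at hv
    split_ifs at hv with hr
    · rw [compCount_congr hr, h0] at hv; omega
    · exact ⟨hv, hr⟩
  obtain ⟨ha, hb, hd, he⟩ := h
  refine ⟨by rwa [supp_addRoot hf], ?_, ?_, ?_⟩
  · intro v
    rw [hc]
    split_ifs with hr
    · rw [compCount_congr hr, h0]; omega
    · exact hb v
  · intro u v hu hv
    rw [supp_addRoot hf]
    exact hd u v (key u hu).1 (key v hv).1
  · intro v hv
    refine C3At_mono (le_addRoot m f) (by rw [supp_addRoot hf]; exact id) ?_ (he v (key v hv).1)
    intro e he0 ht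
    have : e ≠ f := by
      rintro rfl
      exact (key v hv).2 ((touches_iff hf (rep_mem e) v).1 ht)
    simp [addRoot, this]

theorem Is2ERF_addRoot_one {m : P.Ered → ℕ} (h : P.Is2ERF m) {f : P.Ered}
    (hf : f ∈ P.mSupport m) (h1 : ∀ v, P.compCount m v ≤ 1)
    (h3 : P.C3At (addRoot m f) (P.rep f)) : P.Is2ERF (addRoot m f) := by
  have hc := compCount_addRoot hf
  have key : ∀ v, P.compCount (addRoot m f) v = 2 →
      Reachable P.endsRed (P.mSupport m) v (P.rep f) := by
    intro v hv
    rw [hc] at hv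
    have := h1 v
    split_ifs at hv with hr
    · exact hr
    · omega
  refine ⟨by rw [supp_addRoot hf]; exact h.1, ?_, ?_, ?_⟩
  · intro v
    rw [hc]
    have := h1 v
    split_ifs <;> omega
  · intro u v hu hv
    rw [supp_addRoot hf]
    exact (key u hu).trans (key v hv).symm
  · intro v hv
    refine C3At_congr ?_ h3
    rw [supp_addRoot hf]
    exact (key v hv).symm

/-! Adding an edge -/

/-- Give `f` multiplicity one. -/
def addEdge (m : P.Ered → ℕ) (f : P.Ered) : P.Ered → ℕ := fun e => if e = f then 1 else m e

theorem supp_addEdge (m : P.Ered → ℕ) (f : P.Ered) :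
    P.mSupport (addEdge m f) = insert f (P.mSupport m) := by
  ext e
  rw [mem_mSupport, Finset.mem_insert, mem_mSupport]
  unfold addEdge
  split_ifs with h
  · simp [h]
  · simp [h]

theorem le_addEdge {m : P.Ered → ℕ} {f : P.Ered} (hf : m f = 0) (e : P.Ered) :
    m e ≤ addEdge m f e := by
  unfold addEdge
  split_ifs with h
  · subst h; omega
  · exact le_rfl

theorem not_supp {m : P.Ered → ℕ} {f : P.Ered} {u w : P.Vred} (hf : P.endsRed f = s(u, w))
    (hr : ¬ Reachable P.endsRed (P.mSupport m) u w) : m f = 0 := by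
  by_contra h
  exact hr (Reachable.edge (mem_mSupport.2 h) hf)

theorem addEdge_sub_one {m : P.Ered → ℕ} {f : P.Ered} (hf : m f = 0) (e : P.Ered) :
    addEdge m f e - 1 = m e - 1 := by
  unfold addEdge
  split_ifs with h
  · subst h; omega
  · rfl

theorem compCount_addEdge_near {m : P.Ered → ℕ} {f : P.Ered} {u w : P.Vred}
    (hf : P.endsRed f = s(u, w)) (hr : ¬ Reachable P.endsRed (P.mSupport m) u w) :
    P.compCount (addEdge m f) u = P.compCount m u + P.compCount m w := by
  rw [compCount_eq, compCount_eq, compCount_eq, supp_addEdge]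
  have key : ∀ (a : P.Vred) (c : ℕ),
      (if Reachable P.endsRed (insert f (P.mSupport m)) u a then c else 0) =
      (if Reachable P.endsRed (P.mSupport m) u a then c else 0) +
      (if Reachable P.endsRed (P.mSupport m) w a then c else 0) := by
    intro a c
    have hsub := Finset.subset_insert f (P.mSupport m)
    have hi : Reachable P.endsRed (insert f (P.mSupport m)) u a ↔
        (Reachable P.endsRed (P.mSupport m) u a ∨ Reachable P.endsRed (P.mSupport m) w a) := by
      constructor
      · intro h
        rcases Reachable.insert_cases hf h with h | ⟨_, h⟩ | ⟨_, h⟩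
        · exact Or.inl h
        · exact Or.inr h
        · exact Or.inl h
      · rintro (h | h)
        · exact h.mono hsub
        · exact (Reachable.edge (Finset.mem_insert_self _ _) hf).trans (h.mono hsub)
    by_cases h1 : Reachable P.endsRed (P.mSupport m) u a
    · have h2 : ¬ Reachable P.endsRed (P.mSupport m) w a := fun h2 => hr (h1.trans h2.symm)
      simp [hi, h1, h2]
    · simp [hi, h1]
  simp only [addEdge_sub_one (not_supp hf hr), key, Finset.sum_add_distrib]
  omega

theorem reach_addEdge_far {m : P.Ered → ℕ} {f : P.Ered} {u w x : P.Vred}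
    (hf : P.endsRed f = s(u, w)) (hu : ¬ Reachable P.endsRed (P.mSupport m) x u)
    (hw : ¬ Reachable P.endsRed (P.mSupport m) x w) (a : P.Vred) :
    Reachable P.endsRed (insert f (P.mSupport m)) x a ↔ Reachable P.endsRed (P.mSupport m) x a := by
  constructor
  · intro h
    rcases Reachable.insert_cases hf h with h | ⟨h, _⟩ | ⟨h, _⟩
    · exact h
    · exact absurd h hu
    · exact absurd h hw
  · exact Reachable.mono (Finset.subset_insert _ _)

theorem compCount_addEdge_far {m : P.Ered → ℕ} {f : P.Ered} {u w x : P.Vred}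
    (hf : P.endsRed f = s(u, w)) (hr : ¬ Reachable P.endsRed (P.mSupport m) u w)
    (hu : ¬ Reachable P.endsRed (P.mSupport m) x u)
    (hw : ¬ Reachable P.endsRed (P.mSupport m) x w) :
    P.compCount (addEdge m f) x = P.compCount m x := by
  rw [compCount_eq, compCount_eq, supp_addEdge]
  simp only [addEdge_sub_one (not_supp hf hr), reach_addEdge_far hf hu hw]

/-- Master lemma for adding an edge. -/
theorem Is2ERF_addEdge {m : P.Ered → ℕ} (h : P.Is2ERF m) {f : P.Ered} {u w : P.Vred}
    (hf : P.endsRed f = s(u, w)) (hr : ¬ Reachable P.endsRed (P.mSupport m) u w)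
    (hle : P.compCount m u + P.compCount m w ≤ 2)
    (h2 : P.compCount m u + P.compCount m w = 2 →
      P.C3At (addEdge m f) u ∧ ∀ x, P.compCount m x = 2 →
        Reachable P.endsRed (P.mSupport m) x u ∨ Reachable P.endsRed (P.mSupport m) x w) :
    P.Is2ERF (addEdge m f) := by
  obtain ⟨ha, hb, hc, hd⟩ := h
  have hsub := Finset.subset_insert f (P.mSupport m)
  have hedge : Reachable P.endsRed (insert f (P.mSupport m)) u w :=
    Reachable.edge (Finset.mem_insert_self _ _) hf
  have cases : ∀ x, Reachable P.endsRed (insert f (P.mSupport m)) x u ∨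
      (¬ Reachable P.endsRed (P.mSupport m) x u ∧ ¬ Reachable P.endsRed (P.mSupport m) x w) := by
    intro x
    by_cases h1 : Reachable P.endsRed (P.mSupport m) x u
    · exact Or.inl (h1.mono hsub)
    · by_cases h2 : Reachable P.endsRed (P.mSupport m) x w
      · exact Or.inl ((h2.mono hsub).trans hedge.symm)
      · exact Or.inr ⟨h1, h2⟩
  have near : ∀ x, Reachable P.endsRed (insert f (P.mSupport m)) x u →
      P.compCount (addEdge m f) x = P.compCount m u + P.compCount m w := by
    intro x hx
    rw [← compCount_addEdge_near hf hr]
    exact compCount_congr (by rwa [supp_addEdge])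
  refine ⟨?_, ?_, ?_, ?_⟩
  · rw [supp_addEdge]; exact ha.insert_edge hf hr
  · intro x
    rcases cases x with hx | ⟨h1, h2⟩
    · rw [near x hx]; exact hle
    · rw [compCount_addEdge_far hf hr h1 h2]; exact hb x
  · intro x y hx hy
    rw [supp_addEdge]
    rcases cases x with hx' | ⟨hx1, hx2⟩
    · rcases cases y with hy' | ⟨hy1, hy2⟩
      · exact hx'.trans hy'.symm
      · exfalso
        rw [compCount_addEdge_far hf hr hy1 hy2] at hy
        rw [near x hx'] at hx
        rcases (h2 hx).2 y hy with h | h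
        · exact hy1 h
        · exact hy2 h
    · rw [compCount_addEdge_far hf hr hx1 hx2] at hx
      rcases cases y with hy' | ⟨hy1, hy2⟩
      · exfalso
        rw [near y hy'] at hy
        rcases (h2 hy).2 x hx with h | h
        · exact hx1 h
        · exact hx2 h
      · rw [compCount_addEdge_far hf hr hy1 hy2] at hy
        exact (hc x y hx hy).mono hsub
  · intro x hx
    rcases cases x with hx' | ⟨hx1, hx2⟩
    · rw [near x hx'] at hx
      exact C3At_congr (by rw [supp_addEdge]; exact hx'.symm) (h2 hx).1
    · rw [compCount_addEdge_far hf hr hx1 hx2] at hx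
      refine C3At_mono (le_addEdge (not_supp hf hr)) ?_ ?_ (hd x hx)
      · rw [supp_addEdge]; exact (reach_addEdge_far hf hx1 hx2 _).1
      · intro e he _
        have : e ≠ f := by rintro rfl; exact he (not_supp hf hr)
        simp [addEdge, this]

theorem one_le_of_bot {m : P.Ered → ℕ} {v : P.Vred}
    (h : Reachable P.endsRed (P.mSupport m) v (⊥ : P.Vred)) : 1 ≤ P.compCount m v := by
  rw [compCount, if_pos h]; omega

theorem Is2ERF_addEdge_zero {m : P.Ered → ℕ} (h : P.Is2ERF m) {f : P.Ered} {u w : P.Vred}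
    (hf : P.endsRed f = s(u, w)) (hr : ¬ Reachable P.endsRed (P.mSupport m) u w)
    (h0 : P.compCount m u = 0) : P.Is2ERF (addEdge m f) := by
  refine Is2ERF_addEdge h hf hr (by rw [h0, zero_add]; exact h.2.1 w) ?_
  rw [h0, zero_add]
  intro hw
  refine ⟨?_, fun x hx => Or.inr (h.2.2.1 x w hx hw)⟩
  have hedge : Reachable P.endsRed (insert f (P.mSupport m)) u w :=
    Reachable.edge (Finset.mem_insert_self _ _) hf
  refine C3At_congr (u := w) (by rw [supp_addEdge]; exact hedge.symm) ?_
  refine C3At_mono (le_addEdge (not_supp hf hr)) ?_ ?_ (h.2.2.2 w hw)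
  · rw [supp_addEdge]
    intro hb
    rcases Reachable.insert_cases hf hb with h | ⟨_, h⟩ | ⟨_, h⟩
    · exact h
    · exact h
    · have := one_le_of_bot h
      omega
  · intro e he _
    have : e ≠ f := by rintro rfl; exact he (not_supp hf hr)
    simp [addEdge, this]

/-! Existence of a 2-rooted component -/

theorem side_bot : P.side (⊥ : P.Vred) = false := rfl

theorem exists_root {m : P.Ered → ℕ} {v : P.Vred} (h1 : 1 ≤ P.compCount m v)
    (hb : ¬ Reachable P.endsRed (P.mSupport m) v (⊥ : P.Vred)) :
    ∃ f, 2 ≤ m f ∧ Reachable P.endsRed (P.mSupport m) v (P.rep f) := by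
  rw [compCount_eq, if_neg hb, add_zero] at h1
  obtain ⟨f, -, hf⟩ := Finset.exists_ne_zero_of_sum_ne_zero (Nat.one_le_iff_ne_zero.1 h1)
  split_ifs at hf with hr
  · exact ⟨f, by omega, hr⟩
  · exact absurd rfl hf

theorem root_le {m : P.Ered → ℕ} {v : P.Vred} {f : P.Ered}
    (hr : Reachable P.endsRed (P.mSupport m) v (P.rep f)) : m f - 1 ≤ P.compCount m v := by
  rw [compCount_eq]
  have := Finset.single_le_sum (f := fun e =>
    if Reachable P.endsRed (P.mSupport m) v (P.rep e) then m e - 1 else 0)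
    (fun _ _ => Nat.zero_le _) (Finset.mem_univ f)
  simp only [hr, if_true] at this
  omega

/-- Case: a bridging edge in the forest. -/
theorem ext_bridge_in {m : P.Ered → ℕ} (h : P.Is2ERF m) (h1 : ∀ v, P.compCount m v ≤ 1)
    {e : P.Ered} (he : e ∈ P.mSupport m) {a b : P.Vred} (hab : P.endsRed e = s(a, b))
    (hs : P.side a ≠ P.side b) (hpos : 1 ≤ P.compCount m a) :
    ∃ f, P.Is2ERF (addRoot m f) := by
  have hrab : Reachable P.endsRed (P.mSupport m) a b := Reachable.edge he hab
  -- a vertex of any prescribed side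
  have hside : ∀ s : Bool, ∃ y, Reachable P.endsRed (P.mSupport m) a y ∧ P.side y ≠ s := by
    intro s
    by_cases hsa : P.side a = s
    · exact ⟨b, hrab, fun h' => hs (hsa.trans h'.symm)⟩
    · exact ⟨a, Reachable.refl _ _, hsa⟩
  by_cases hb : Reachable P.endsRed (P.mSupport m) a (⊥ : P.Vred)
  · obtain ⟨y, hay, hy⟩ := hside false
    obtain ⟨p, hp, hpF⟩ := (hb.symm.trans hay).exists_path
    obtain ⟨f, hf⟩ : ∃ f, p.edges.getLast? = some f := by
      cases p with
      | nil => exact absurd side_bot hy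
      | cons g c hg p => exact ⟨_, List.getLast?_eq_some_getLast (by simp [MWalk.edges])⟩
    have hfF : f ∈ P.mSupport m := hpF f (List.mem_of_getLast? hf)
    refine ⟨f, Is2ERF_addRoot_one h hfF h1 ?_⟩
    have hyf : Reachable P.endsRed (P.mSupport m) y (P.rep f) :=
      Reachable.of_mem hfF (p.end_mem_last hf) (rep_mem f)
    constructor
    · intro _
      refine ⟨y, p, hp, by rwa [supp_addRoot hfF], ⟨f, hf, ?_⟩, ?_⟩
      · rw [addRoot_self]
        rw [mem_mSupport] at hfF
        omega
      · rw [MWalk.odd_bridgeCount, side_bot]; exact hy.symm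
    · intro hn
      rw [supp_addRoot hfF] at hn
      exact absurd (hyf.symm.trans (hay.symm.trans hb)) hn
  · obtain ⟨f, hf2, hrf⟩ := exists_root hpos hb
    have hfF : f ∈ P.mSupport m := by rw [mem_mSupport]; omega
    have hfm : m f = 2 := by
      have := root_le hrf
      have := h1 a
      omega
    obtain ⟨c, hc⟩ := Sym2.mem_iff_exists.1 (rep_mem f)
    by_cases hsc : P.side (P.rep f) = P.side c
    · obtain ⟨y, hay, hy⟩ := hside (P.side c)
      obtain ⟨z, p, l, hp, hpF, hpe, hfl⟩ := h.1.path_to_edge hfF (rep_mem f) (hay.symm.trans hrf)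
      have hlast : p.edges.getLast? = some f := by simp [hpe]
      have hz : z ∈ P.endsRed f := p.end_mem_last hlast
      have hsf : ∀ x ∈ P.endsRed f, P.side x = P.side c := by
        intro x hx
        rw [hc, Sym2.mem_iff] at hx
        rcases hx with rfl | rfl
        · exact hsc
        · rfl
      cases l with
      | nil =>
        exfalso
        have : p.edges.head? = some f := by simp [hpe]
        exact hy (hsf y (p.start_mem_head this))
      | cons g l =>
        have hhead : p.edges.head? = some g := by simp [hpe]
        have hgf : f ≠ g := fun h' => hfl (by simp [h'])
        have hgF : g ∈ P.mSupport m := hpF g (by simp [hpe])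
        refine ⟨g, Is2ERF_addRoot_one h hgF h1 ?_⟩
        have hyg : Reachable P.endsRed (P.mSupport m) y (P.rep g) :=
          Reachable.of_mem hgF (p.start_mem_head hhead) (rep_mem g)
        constructor
        · intro hn
          rw [supp_addRoot hgF] at hn
          exact absurd (hay.trans (hyg.trans hn)) hb
        · intro _
          refine ⟨y, z, p, hp, by rwa [supp_addRoot hgF], by rw [supp_addRoot hgF]; exact hyg.symm,
            ⟨g, hhead, ?_⟩, ⟨f, hlast, ?_⟩, ?_, ?_⟩
          · rw [addRoot_self]
            rw [mem_mSupport] at hgF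
            omega
          · exact hf2.trans (le_addRoot m g f)
          · intro e' he'
            rw [hpe] at he'
            simp at he'
          · rw [MWalk.odd_bridgeCount, hsf z hz]; exact hy
    · refine ⟨f, Is2ERF_addRoot_one h hfF h1 ⟨?_, ?_⟩⟩
      · intro hn
        rw [supp_addRoot hfF] at hn
        exact absurd (hrf.trans hn) hb
      · intro _
        have h3 : addRoot m f f = 3 := by rw [addRoot_self, hfm]
        refine ⟨P.rep f, c, MWalk.cons f c hc (MWalk.nil c), ?_, ?_, Reachable.refl _ _,
          ⟨f, by simp [MWalk.edges], by omega⟩, ⟨f, by simp [MWalk.edges], by omega⟩, ?_, ?_⟩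
        · have : P.rep f ≠ c := fun h' => hsc (by rw [h'])
          simp [MWalk.IsPath, MWalk.support, this]
        · rw [supp_addRoot hfF]
          intro g hg
          simp only [MWalk.edges, List.mem_singleton] at hg
          subst hg; exact hfF
        · intro g hg
          simp only [MWalk.edges, List.cons.injEq, and_true] at hg
          subst hg; exact h3
        · rw [MWalk.odd_bridgeCount]; exact hsc

theorem side_const {m : P.Ered → ℕ}
    (hnb : ∀ e ∈ P.mSupport m, ∀ a b, P.endsRed e = s(a, b) → P.side a = P.side b)
    {x y : P.Vred} (h : Reachable P.endsRed (P.mSupport m) x y) : P.side x = P.side y := by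
  obtain ⟨p, hp⟩ := h
  by_contra hne
  obtain ⟨e, he, a, b, hab, hs⟩ := p.exists_bridge P.side hne
  exact hs (hnb e (hp e he) a b hab)

/-- Case: bridging edge outside of the forest, one side containing `0̄`. -/
theorem C3_bot {m : P.Ered → ℕ} (h : P.Is2ERF m)
    (hnb : ∀ e ∈ P.mSupport m, ∀ a b, P.endsRed e = s(a, b) → P.side a = P.side b)
    {e : P.Ered} {u w : P.Vred} (he : P.endsRed e = s(u, w)) (hs : P.side u ≠ P.side w)
    (hw : 1 ≤ P.compCount m w)
    (hb : Reachable P.endsRed (P.mSupport m) u (⊥ : P.Vred)) :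
    P.C3At (addEdge m e) u := by
  have hr : ¬ Reachable P.endsRed (P.mSupport m) u w := fun h' => hs (side_const hnb h')
  have hsub := Finset.subset_insert e (P.mSupport m)
  have hedge : Reachable P.endsRed (insert e (P.mSupport m)) u w :=
    Reachable.edge (Finset.mem_insert_self _ _) he
  have hbw : ¬ Reachable P.endsRed (P.mSupport m) w (⊥ : P.Vred) :=
    fun h' => hr (hb.trans h'.symm)
  obtain ⟨f, hf2, hrf⟩ := exists_root hw hbw
  have hfF : f ∈ P.mSupport m := by rw [mem_mSupport]; omega
  constructor
  · intro _
    obtain ⟨z, p, l, hp, hpF, hpe, -⟩ := (h.1.insert_edge he hr).path_to_edge (hsub hfF) (rep_mem f)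
      ((hb.symm.mono hsub).trans (hedge.trans (hrf.mono hsub)))
    have hlast : p.edges.getLast? = some f := by simp [hpe]
    refine ⟨z, p, hp, by rwa [supp_addEdge], ⟨f, hlast,
      hf2.trans (le_addEdge (not_supp he hr) f)⟩, ?_⟩
    rw [MWalk.odd_bridgeCount, ← side_const hnb hb,
      ← side_const hnb (hrf.trans (Reachable.of_mem hfF (rep_mem f) (p.end_mem_last hlast)))]
    exact hs
  · intro hn
    rw [supp_addEdge] at hn
    exact absurd (hb.mono hsub) hn

theorem ext_bridge_out {m : P.Ered → ℕ} (h : P.Is2ERF m) (h1 : ∀ v, P.compCount m v ≤ 1)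
    (hnb : ∀ e ∈ P.mSupport m, ∀ a b, P.endsRed e = s(a, b) → P.side a = P.side b)
    {e : P.Ered} {u w : P.Vred} (he : P.endsRed e = s(u, w)) (hs : P.side u ≠ P.side w)
    (hu : 1 ≤ P.compCount m u) (hw : 1 ≤ P.compCount m w) :
    m e = 0 ∧ P.Is2ERF (addEdge m e) := by
  have hr : ¬ Reachable P.endsRed (P.mSupport m) u w := fun h' => hs (side_const hnb h')
  refine ⟨not_supp he hr, Is2ERF_addEdge h he hr ?_ fun _ => ⟨?_, ?_⟩⟩
  · have := h1 u
    have := h1 w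
    omega
  · have hsub := Finset.subset_insert e (P.mSupport m)
    have hedge : Reachable P.endsRed (insert e (P.mSupport m)) u w :=
      Reachable.edge (Finset.mem_insert_self _ _) he
    by_cases hbu : Reachable P.endsRed (P.mSupport m) u (⊥ : P.Vred)
    · exact C3_bot h hnb he hs hw hbu
    by_cases hbw : Reachable P.endsRed (P.mSupport m) w (⊥ : P.Vred)
    · have := C3_bot h hnb (by rw [he, Sym2.eq_swap]) hs.symm hu hbw
      exact C3At_congr (by rw [supp_addEdge]; exact hedge.symm) this
    obtain ⟨f₁, hf₁, hr₁⟩ := exists_root hu hbu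
    obtain ⟨f₂, hf₂, hr₂⟩ := exists_root hw hbw
    have hF₁ : f₁ ∈ P.mSupport m := by rw [mem_mSupport]; omega
    have hF₂ : f₂ ∈ P.mSupport m := by rw [mem_mSupport]; omega
    have hne : f₁ ≠ f₂ := by
      rintro rfl
      exact hr (hr₁.trans hr₂.symm)
    constructor
    · intro hn
      rw [supp_addEdge] at hn
      rcases Reachable.insert_cases he hn with h | ⟨_, h⟩ | ⟨_, h⟩
      · exact absurd h hbu
      · exact absurd h hbw
      · exact absurd h hbu
    · intro _
      obtain ⟨x, y, p, hp, hpF, hhead, hlast⟩ := (h.1.insert_edge he hr).path_two_edges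
        (hsub hF₁) (hsub hF₂) hne (rep_mem f₁) (rep_mem f₂)
        ((hr₁.symm.mono hsub).trans (hedge.trans (hr₂.mono hsub)))
      have hx := hr₁.trans (Reachable.of_mem hF₁ (rep_mem f₁) (p.start_mem_head hhead))
      have hy := hr₂.trans (Reachable.of_mem hF₂ (rep_mem f₂) (p.end_mem_last hlast))
      refine ⟨x, y, p, hp, by rwa [supp_addEdge], by rw [supp_addEdge]; exact hx.mono hsub,
        ⟨f₁, hhead, hf₁.trans (le_addEdge (not_supp he hr) _)⟩,
        ⟨f₂, hlast, hf₂.trans (le_addEdge (not_supp he hr) _)⟩, ?_, ?_⟩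
      · intro g hg
        rw [hg] at hhead hlast
        simp only [List.head?_cons, List.getLast?_singleton, Option.some.injEq] at hhead hlast
        exact absurd (hhead.symm.trans hlast) hne
      · rw [MWalk.odd_bridgeCount, ← side_const hnb hx, ← side_const hnb hy]
        exact hs
  · intro x hx
    have := h1 x
    omega

/-! The degree formula -/

/-- The vertex `v ≠ 0̄` has no non-loop edges. -/
def Iso (P : BiconedGraph) (v : P.Vred) : Prop :=
  v ≠ ⊥ ∧ ∀ e w, P.endsRed e = s(v, w) → w = v

theorem iso_reach {F : Finset P.Ered} {v x : P.Vred} (hv : P.Iso v)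
    (h : Reachable P.endsRed F x v) : x = v := by
  refine Reachable.ind (motive := fun x => x = v) rfl ?_ h
  rintro a b e - hab - rfl
  exact hv.2 e a (by rw [hab, Sym2.eq_swap])

theorem iso_count {m : P.Ered → ℕ} (h : P.Is2ERF m) {v : P.Vred} (hv : P.Iso v) :
    P.compCount m v = 0 := by
  by_contra hne
  have hb : ¬ Reachable P.endsRed (P.mSupport m) v (⊥ : P.Vred) :=
    fun h' => hv.1 (iso_reach hv h'.symm).symm
  obtain ⟨f, hf, hr⟩ := exists_root (Nat.one_le_iff_ne_zero.2 hne) hb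
  have hF : f ∈ P.mSupport m := by rw [mem_mSupport]; omega
  obtain ⟨c, hc⟩ := Sym2.mem_iff_exists.1 (rep_mem f)
  have := iso_reach hv hr.symm
  rw [this] at hc
  exact h.1.not_loop hF hc (hv.2 f c hc).symm

theorem count_iso {m : P.Ered → ℕ} (h : P.Is2ERF m)
    (hmax : ∀ m' : P.Ered → ℕ, P.Is2ERF m' → (∀ e, m e ≤ m' e) → m' = m) {v : P.Vred}
    (hv : P.compCount m v = 0) : P.Iso v := by
  refine ⟨?_, ?_⟩
  · rintro rfl
    have := one_le_of_bot (m := m) (Reachable.refl _ (⊥ : P.Vred))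
    omega
  · intro e w he
    by_contra hwv
    by_cases hr : Reachable P.endsRed (P.mSupport m) v w
    · obtain ⟨p, hp⟩ := hr
      cases p with
      | nil => exact hwv rfl
      | cons f c hf p =>
        have hfF : f ∈ P.mSupport m := hp f (by simp [MWalk.edges])
        have hvf : Reachable P.endsRed (P.mSupport m) v (P.rep f) :=
          Reachable.of_mem hfF (by rw [hf]; simp) (rep_mem f)
        have h0 : P.compCount m (P.rep f) = 0 := by rw [← compCount_congr hvf, hv]
        have := congrFun (hmax _ (Is2ERF_addRoot_zero h hfF h0) (le_addRoot m f)) f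
        rw [addRoot_self] at this
        omega
    · have hm := not_supp he hr
      have := congrFun (hmax _ (Is2ERF_addEdge_zero h he hr hv) (le_addEdge hm)) e
      rw [addEdge, if_pos rfl, hm] at this
      omega

theorem two_iff {m : P.Ered → ℕ} (h : P.Is2ERF m)
    (hmax : ∀ m' : P.Ered → ℕ, P.Is2ERF m' → (∀ e, m e ≤ m' e) → m' = m) :
    (∃ v, P.compCount m v = 2) ↔ ∃ e, P.BridgingE e := by
  constructor
  · rintro ⟨v, hv⟩
    have hc := h.2.2.2 v hv
    have fin : ∀ {x y : P.Vred} (p : MWalk P.endsRed x y), Odd (p.bridgeCount P.side) →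
        ∃ e, P.BridgingE e := by
      intro x y p ho
      obtain ⟨e, -, a, b, hab, hs⟩ := p.exists_bridge P.side ((p.odd_bridgeCount P.side).1 ho)
      exact ⟨e, a, b, hab, hs⟩
    by_cases hb : Reachable P.endsRed (P.mSupport m) v (⊥ : P.Vred)
    · obtain ⟨x, p, -, -, -, ho⟩ := hc.1 hb
      exact fin p ho
    · obtain ⟨x, y, p, -, -, -, -, -, -, ho⟩ := hc.2 hb
      exact fin p ho
  · rintro ⟨e, u, w, he, hs⟩
    by_contra hno
    have h1 : ∀ v, P.compCount m v ≤ 1 := by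
      intro v
      have h2 := h.2.1 v
      have h3 : P.compCount m v ≠ 2 := fun h' => hno ⟨v, h'⟩
      omega
    have hpos : ∀ (e : P.Ered) (a b : P.Vred), P.endsRed e = s(a, b) → P.side a ≠ P.side b →
        1 ≤ P.compCount m a := by
      intro e a b hab hs
      by_contra h0
      have := (count_iso h hmax (by omega : P.compCount m a = 0)).2 e b hab
      exact hs (by rw [this])
    by_cases hin : ∃ e ∈ P.mSupport m, ∃ a b, P.endsRed e = s(a, b) ∧ P.side a ≠ P.side b
    · obtain ⟨g, hg, a, b, hab, hs'⟩ := hin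
      obtain ⟨f, hf⟩ := ext_bridge_in h h1 hg hab hs' (hpos g a b hab hs')
      have := congrFun (hmax _ hf (le_addRoot m f)) f
      rw [addRoot_self] at this
      omega
    · have hnb : ∀ e ∈ P.mSupport m, ∀ a b, P.endsRed e = s(a, b) → P.side a = P.side b := by
        intro g hg a b hab
        by_contra hs'
        exact hin ⟨g, hg, a, b, hab, hs'⟩
      obtain ⟨hm, hf⟩ := ext_bridge_out h h1 hnb he hs (hpos e u w he hs)
        (hpos e w u (by rw [he, Sym2.eq_swap]) hs.symm)
      have := congrFun (hmax _ hf (le_addEdge hm)) e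
      rw [addEdge, if_pos rfl, hm] at this
      omega

instance : Fintype P.Vred := inferInstanceAs (Fintype (Option (Fin P.m ⊕ Fin P.n)))

theorem sum_count {m : P.Ered → ℕ} (h : P.Is2ERF m) :
    P.deg m + 1 + Fintype.card (Quotient (reachSetoid P.endsRed (P.mSupport m))) =
      Fintype.card P.Vred +
      ∑ q : Quotient (reachSetoid P.endsRed (P.mSupport m)), P.compCount m q.out := by
  have hout : ∀ (q : Quotient (reachSetoid P.endsRed (P.mSupport m))) (a : P.Vred),
      Reachable P.endsRed (P.mSupport m) q.out a ↔ q = Quotient.mk _ a := by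
    intro q a
    rw [← mk_eq_iff, Quotient.out_eq]
  have hsum : ∑ q : Quotient (reachSetoid P.endsRed (P.mSupport m)), P.compCount m q.out =
      (∑ e, (m e - 1)) + 1 := by
    simp only [compCount_eq, hout, Finset.sum_add_distrib]
    rw [Finset.sum_comm]
    simp
  have hdeg : P.deg m = (∑ e, (m e - 1)) + (P.mSupport m).card := by
    rw [deg, mSupport, Finset.card_filter, ← Finset.sum_add_distrib]
    refine Finset.sum_congr rfl fun e _ => ?_
    split_ifs <;> omega
  have := h.1.card_add
  omega

theorem deg_formula {m : P.Ered → ℕ} (h : P.Is2ERF m)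
    (hmax : ∀ m' : P.Ered → ℕ, P.Is2ERF m' → (∀ e, m e ≤ m' e) → m' = m) :
    P.deg m + 1 + Fintype.card {v : P.Vred // P.Iso v} =
      Fintype.card P.Vred + if ∃ e, P.BridgingE e then 1 else 0 := by
  have h1 := sum_count h
  have hsum : (∑ q : Quotient (reachSetoid P.endsRed (P.mSupport m)), P.compCount m q.out) +
      (∑ q : Quotient (reachSetoid P.endsRed (P.mSupport m)),
        if P.compCount m q.out = 0 then 1 else 0) =
      (∑ q : Quotient (reachSetoid P.endsRed (P.mSupport m)),
        if P.compCount m q.out = 2 then 1 else 0) +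
      Fintype.card (Quotient (reachSetoid P.endsRed (P.mSupport m))) := by
    rw [← Finset.card_univ, Finset.card_eq_sum_ones, ← Finset.sum_add_distrib,
      ← Finset.sum_add_distrib]
    refine Finset.sum_congr rfl fun q _ => ?_
    have := h.2.1 q.out
    split_ifs <;> omega
  have hout : ∀ v, Reachable P.endsRed (P.mSupport m)
      (Quotient.mk (reachSetoid P.endsRed (P.mSupport m)) v).out v := by
    intro v
    rw [← mk_eq_iff, Quotient.out_eq]
  have hzero : (∑ q : Quotient (reachSetoid P.endsRed (P.mSupport m)),
        if P.compCount m q.out = 0 then 1 else 0) = Fintype.card {v : P.Vred // P.Iso v} := by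
    rw [← Finset.card_filter, ← Fintype.card_subtype]
    symm
    refine Fintype.card_of_bijective (f := fun v : {v : P.Vred // P.Iso v} =>
      (⟨Quotient.mk _ v.1, by rw [compCount_congr (hout v.1)]; exact iso_count h v.2⟩ :
        {q : Quotient (reachSetoid P.endsRed (P.mSupport m)) // P.compCount m q.out = 0})) ⟨?_, ?_⟩
    · rintro ⟨v, hv⟩ ⟨w, hw⟩ hvw
      simp only [Subtype.mk.injEq, mk_eq_iff] at hvw
      exact Subtype.ext (iso_reach hw hvw)
    · rintro ⟨q, hq⟩
      exact ⟨⟨q.out, count_iso h hmax hq⟩, Subtype.ext (Quotient.out_eq q)⟩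
  have htwo : (∑ q : Quotient (reachSetoid P.endsRed (P.mSupport m)),
        if P.compCount m q.out = 2 then 1 else 0) = if ∃ e, P.BridgingE e then 1 else 0 := by
    rw [← Finset.card_filter]
    by_cases hB : ∃ e, P.BridgingE e
    · rw [if_pos hB, Finset.card_eq_one]
      obtain ⟨v, hv⟩ := (two_iff h hmax).2 hB
      refine ⟨Quotient.mk _ v, ?_⟩
      ext q
      simp only [Finset.mem_filter, Finset.mem_univ, true_and, Finset.mem_singleton]
      constructor
      · intro hq
        rw [← Quotient.out_eq q, mk_eq_iff]
        exact h.2.2.1 _ _ hq hv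
      · rintro rfl
        rw [compCount_congr (hout v), hv]
    · rw [if_neg hB, Finset.card_eq_zero, Finset.filter_eq_empty_iff]
      intro q _ hq
      exact hB ((two_iff h hmax).1 ⟨_, hq⟩)
  omega

end BiconedGraph

/-- Lemma 4.4.  The multicomplex of 2-edge-rooted forests of
`G^{A,B}_red` is pure:  any two inclusion-maximal 2-edge-rooted forests have
the same degree. -/
theorem twoEdgeRootedForests_pure (P : BiconedGraph)
    (m₁ m₂ : P.Ered → ℕ) (h₁ : P.Is2ERF m₁) (h₂ : P.Is2ERF m₂)
    (hmax₁ : ∀ m' : P.Ered → ℕ, P.Is2ERF m' → (∀ e, m₁ e ≤ m' e) → m' = m₁)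
    (hmax₂ : ∀ m' : P.Ered → ℕ, P.Is2ERF m' → (∀ e, m₂ e ≤ m' e) → m' = m₂) :
    P.deg m₁ = P.deg m₂ := by
  have e₁ := BiconedGraph.deg_formula h₁ hmax₁
  have e₂ := BiconedGraph.deg_formula h₂ hmax₂
  omega

end

end BiconedPaper
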